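/- Let k ≥ 2 be an even integer. If G is a finite simple graph that contains no non-empty k-divisible subgraph, then G is (2q(3k/2) − 2)-degenerate. -/

import Mathlib

/-- A graph is `k`-divisible if every vertex has degree divisible by `k`. -/
def KDivisible {V : Type*} (k : ℕ) (H : SimpleGraph V) : Prop :=
  ∀ v : V, k ∣ {u : V | H.Adj v u}.ncard

/-- `G` contains no non-empty `k`-divisible subgraph. -/
def NoKDivisibleSubgraph {V : Type*} (k : ℕ) (G : SimpleGraph V) : Prop :=
  ∀ H : SimpleGraph V, H ≤ G → KDivisible k H → H = ⊥

/-- `q m` is the smallest prime that is greater than or equal to `m`. -/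
noncomputable def q (m : ℕ) : ℕ :=
  sInf {p : ℕ | p.Prime ∧ m ≤ p}

/-- A graph is `d`-degenerate if there is an ordering of its vertices in which every
vertex has at most `d` neighbours preceding it. -/
def Degenerate {V : Type*} (G : SimpleGraph V) (d : ℕ) : Prop :=
  ∃ o : V → ℕ, Function.Injective o ∧ ∀ v : V, {u : V | G.Adj v u ∧ o u < o v}.ncard ≤ d

open Finset

section Gadget

variable {D T : Type*} {s : ℕ}

/-- The graph on darts and auxiliary vertices used to reduce factors to perfect matchings: a dart is
joined to its reverse and to the `s` auxiliary vertices at its endpoint. -/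
def factorGadget (σ : D → D) (τ : D → T) (s : ℕ) : SimpleGraph (D ⊕ T × Fin s) :=
  SimpleGraph.fromRel fun x y =>
    (∃ d, x = .inl d ∧ y = .inl (σ d)) ∨ ∃ d i, x = .inl d ∧ y = .inr (τ d, i)

lemma factorGadget_adj_inl_inl {σ : D → D} (hσ : σ.Involutive) {τ : D → T} {d e : D} :
    (factorGadget σ τ s).Adj (.inl d) (.inl e) ↔ d ≠ e ∧ σ d = e := by
  simp only [factorGadget, SimpleGraph.fromRel_adj]
  have := hσ d
  have := hσ e
  simp
  grind

lemma factorGadget_adj_inl_inr {σ : D → D} {τ : D → T} {d : D} {x : T × Fin s} :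
    (factorGadget σ τ s).Adj (.inl d) (.inr x) ↔ τ d = x.1 := by
  obtain ⟨t, i⟩ := x
  simp [factorGadget, eq_comm]

lemma factorGadget_adj_inr_inr {σ : D → D} {τ : D → T} {x y : T × Fin s} :
    ¬ (factorGadget σ τ s).Adj (.inr x) (.inr y) := by
  simp [factorGadget]

open Classical in
/-- The contribution of the dart `d` to the weight of the edge boundary of `C` in the gadget, where
edges between darts have weight `k`. -/
noncomputable def cutWeight (σ : D → D) (τ : D → T) (k : ℕ) (C : Finset (D ⊕ T × Fin s)) (d : D) :
    ℕ :=
  #{i : Fin s | ¬ (.inl d ∈ C ↔ .inr (τ d, i) ∈ C)} +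
    if .inl d ∈ C ∧ (σ d = d ∨ .inl (σ d) ∉ C) then k else 0

open Classical in
lemma cutWeight_le {σ : D → D} (hσ : σ.Involutive) {τ : D → T} (k : ℕ)
    {C U : Finset (D ⊕ T × Fin s)}
    (hCU : ∀ x ∈ C, ∀ y, (factorGadget σ τ s).Adj x y → y ∈ C ∨ y ∈ U) (d : D) :
    cutWeight σ τ k C d ≤
      (if .inl d ∈ C then ∑ i : Fin s, (if .inr (τ d, i) ∈ U then 1 else 0) +
        ((if .inl (σ d) ∈ U then k else 0) + if σ d = d then k else 0) else 0) +
      if .inl d ∈ U then ∑ i : Fin s, (if .inr (τ d, i) ∈ C then 1 else 0) else 0 := by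
  unfold cutWeight
  have hadj : ∀ i : Fin s, (factorGadget σ τ s).Adj (.inl d) (.inr (τ d, i)) :=
    fun i => factorGadget_adj_inl_inr.2 rfl
  rw [card_filter]
  by_cases hd : .inl d ∈ C
  · simp only [hd, true_and, true_iff, if_true]
    refine le_trans (add_le_add (sum_le_sum fun i _ => ?_) ?_) (Nat.le_add_right _ _)
    · have := hCU _ hd _ (hadj i)
      split_ifs <;> simp_all
    · by_cases hf : σ d = d
      · simp [hf]
      · have := hCU _ hd _ ((factorGadget_adj_inl_inl hσ).2 ⟨Ne.symm hf, rfl⟩)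
        split_ifs <;> simp_all
  · simp only [hd, false_and, false_iff, if_false, not_not, add_zero, zero_add]
    split_ifs with hU
    · exact le_rfl
    · rw [Nat.le_zero, sum_eq_zero_iff]
      intro i _
      rw [if_neg]
      intro hi
      have := hCU _ hi _ (hadj i).symm
      tauto

variable [Fintype D] [Fintype T]

open Classical in
lemma le_sum_cutWeight {σ : D → D} (hσ : σ.Involutive) {τ : D → T} {k r : ℕ}
    (hk : Even k) (hkr : k + s = r) (hrs : r ≤ 3 * s)
    (hfib : ∀ t, #{d | τ d = t} = r)
    (hcut : ∀ B : Finset T, B.Nonempty → B ≠ univ →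
      1 < #{d | τ d ∈ B ∧ (σ d = d ∨ τ (σ d) ∉ B)})
    (C : Finset (D ⊕ T × Fin s)) (hC : Odd #C) :
    r ≤ ∑ d, cutWeight σ τ k C d ∨ ∃ d, σ d = d ∧ C = univ.erase (.inl d) := by
  by_cases hmix : ∃ t i j, .inr (t, i) ∈ C ∧ .inr (t, j) ∉ C
  · left
    obtain ⟨t, i, j, hi, hj⟩ := hmix
    calc r = ∑ d with τ d = t, 1 := by simp [hfib]
      _ ≤ ∑ d with τ d = t, cutWeight σ τ k C d := by
        refine sum_le_sum fun d hd => ?_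
        obtain rfl : τ d = t := by simpa using hd
        have : 0 < #{i : Fin s | ¬ (.inl d ∈ C ↔ .inr (τ d, i) ∈ C)} := by
          rw [card_pos]
          by_cases hdC : .inl d ∈ C
          · exact ⟨j, by simp [hdC, hj]⟩
          · exact ⟨i, by simp [hdC, hi]⟩
        unfold cutWeight
        omega
      _ ≤ _ := sum_le_univ_sum_of_nonneg fun _ => Nat.zero_le _
  push Not at hmix
  set B : Finset T := {t | ∃ i, .inr (t, i) ∈ C} with hB
  have hBC : ∀ t i, .inr (t, i) ∈ C ↔ t ∈ B := by
    intro t i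
    simp only [hB, mem_filter, mem_univ, true_and]
    exact ⟨fun h => ⟨i, h⟩, fun ⟨j, hj⟩ => hmix t j i hj⟩
  set P : Finset D := {d | ¬ (.inl d ∈ C ↔ τ d ∈ B)} with hP
  set K : Finset D := {d | .inl d ∈ C ∧ (σ d = d ∨ .inl (σ d) ∉ C)} with hK
  have hsum : ∑ d, cutWeight σ τ k C d = s * #P + k * #K := by
    have h1 : ∀ d, #{i : Fin s | ¬ (.inl d ∈ C ↔ .inr (τ d, i) ∈ C)} = if d ∈ P then s else 0 := by
      intro d
      by_cases h : d ∈ P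
      · have : ¬ (.inl d ∈ C ↔ τ d ∈ B) := by simpa [hP] using h
        simp [hBC, this, h]
      · have : (.inl d ∈ C ↔ τ d ∈ B) := by simpa [hP] using h
        simp [hBC, this, h]
    simp only [cutWeight, sum_add_distrib, h1]
    simp [← sum_filter, hK, mul_comm]
  have hPodd : Odd #P := by
    have hcard : #C.toLeft + s * #B = #C := by
      rw [← card_toLeft_add_card_toRight]
      have : C.toRight = B ×ˢ univ := by
        ext ⟨t, i⟩
        simp [hBC]
      rw [this, card_product, card_univ, Fintype.card_fin, mul_comm]
    set F : Finset D := {d | τ d ∈ B} with hFdef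
    have hF : #F = r * #B := by
      rw [card_eq_sum_card_fiberwise (f := τ) (t := B) (by intro d; simp [hFdef]),
        sum_const_nat (m := r), mul_comm]
      intro t ht
      rw [← hfib t, hFdef, filter_filter]
      congr 1
      ext d
      simp only [mem_filter, mem_univ, true_and]
      grind
    have hPs : P = symmDiff C.toLeft F := by
      ext d
      simp [hP, hFdef, mem_symmDiff]
      tauto
    have h1 : #P + 2 * #(C.toLeft ∩ F) = #C.toLeft + #F := by
      rw [hPs, symmDiff_def, sup_eq_union, card_union_of_disjoint disjoint_sdiff_sdiff]
      have := card_sdiff_add_card_inter C.toLeft F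
      have := card_sdiff_add_card_inter F C.toLeft
      rw [inter_comm] at this
      omega
    obtain ⟨j, rfl⟩ := hk
    subst hkr
    rw [hF, add_mul, add_mul] at h1
    rw [Nat.odd_iff] at *
    omega
  rw [hsum]
  by_cases hP3 : 3 ≤ #P
  · left
    nlinarith [Nat.mul_le_mul_left s hP3, Nat.zero_le (k * #K)]
  by_cases hK0 : 0 < #K
  · left
    have := hPodd.pos
    nlinarith
  right
  have hP1 : #P = 1 := by
    rw [Nat.odd_iff] at hPodd
    omega
  obtain ⟨d₀, hd₀⟩ := card_eq_one.1 hP1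
  have hKe : ∀ d, .inl d ∈ C → σ d ≠ d ∧ .inl (σ d) ∈ C := by
    intro d hd
    have : d ∉ K := by
      rw [Nat.pos_iff_ne_zero, not_not, card_eq_zero] at hK0
      simp [hK0]
    simpa [hK, hd] using this
  have hPd : ∀ d, d ≠ d₀ ↔ (.inl d ∈ C ↔ τ d ∈ B) := by
    intro d
    have : d ∈ P ↔ d = d₀ := by simp [hd₀]
    rw [Ne, ← this]
    simp [hP]
  have hBtriv : B = ∅ ∨ B = univ := by
    by_contra! h
    have := hcut B h.1 h.2
    rw [one_lt_card] at this
    obtain ⟨a, ha, b, hb, hab⟩ := this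
    simp only [mem_filter, mem_univ, true_and] at ha hb
    have key : ∀ a, τ a ∈ B ∧ (σ a = a ∨ τ (σ a) ∉ B) → a = d₀ ∨ σ a = d₀ := by
      intro a ha
      by_contra! h
      have h1 := (hPd a).1 h.1
      have h2 := (hPd (σ a)).1 h.2
      have := hKe a (h1.2 ha.1)
      tauto
    have hσa := hσ a
    have hσb := hσ b
    rcases key a ha with h1 | h1 <;> rcases key b hb with h2 | h2
    · exact hab (h1.trans h2.symm)
    · grind
    · grind
    · exact hab (hσ.injective (h1.trans h2.symm))
  rcases hBtriv with h | h
  · exfalso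
    have h0 : .inl d₀ ∈ C := by
      by_contra h'
      exact (hPd d₀).2 (by simp [h, h']) rfl
    have h1 := hKe d₀ h0
    have := ((hPd _).1 h1.1).1 h1.2
    simp [h] at this
  · have h0 : .inl d₀ ∉ C := by
      intro h'
      exact (hPd d₀).2 (by simp [h, h']) rfl
    have h1 : ∀ d, d ≠ d₀ → .inl d ∈ C := fun d hd => ((hPd d).1 hd).2 (by simp [h])
    refine ⟨d₀, ?_, ?_⟩
    · by_contra h'
      have := hKe _ (h1 _ h')
      rw [hσ] at this
      exact h0 this.2
    · ext x
      rcases x with d | ⟨t, i⟩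
      · by_cases hd : d = d₀
        · simp [hd, h0]
        · simp [hd, h1]
      · simp [hBC, h]

lemma sum_ite_mem_le {α : Type*} [DecidableEq α] {S : Finset (Finset α)}
    (hS : ∀ C ∈ S, ∀ C' ∈ S, C ≠ C' → Disjoint C C') (x : α) (a : ℕ) :
    ∑ C ∈ S, (if x ∈ C then a else 0) ≤ a := by
  rw [← sum_filter, sum_const, smul_eq_mul]
  have : #{C ∈ S | x ∈ C} ≤ 1 := by
    rw [card_le_one]
    intro C hC C' hC'
    rw [mem_filter] at hC hC'
    by_contra hne
    exact disjoint_left.1 (hS C hC.1 C' hC'.1 hne) hC.2 hC'.2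
  nlinarith

lemma sum_ite_mem_eq_mul {α β : Type*} [Fintype α] [DecidableEq β] {g : α → β} {A : Finset α} {U : Finset β}
    (hA : ∀ x, g x ∈ U ↔ x ∈ A) (a : ℕ) : ∑ x, (if g x ∈ U then a else 0) = a * #A := by
  rw [← sum_filter, sum_const, smul_eq_mul, mul_comm]
  congr 2
  ext x
  simp [hA]

open Classical in
lemma sum_sum_ite_inr_mem {τ : D → T} {r : ℕ} (hfib : ∀ t, #{d | τ d = t} = r)
    (U : Finset (D ⊕ T × Fin s)) :
    ∑ d, ∑ i : Fin s, (if .inr (τ d, i) ∈ U then 1 else 0) = r * #U.toRight := by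
  rw [sum_comm]
  calc ∑ i : Fin s, ∑ d, (if .inr (τ d, i) ∈ U then 1 else 0)
      = ∑ i : Fin s, ∑ t, ∑ d with τ d = t, (if .inr (τ d, i) ∈ U then 1 else 0) := by
        exact sum_congr rfl fun i _ => (sum_fiberwise _ _ _).symm
    _ = ∑ i : Fin s, ∑ t, (if .inr (t, i) ∈ U then r else 0) := by
        refine sum_congr rfl fun i _ => sum_congr rfl fun t _ => ?_
        rw [sum_congr rfl (g := fun _ => if .inr (t, i) ∈ U then 1 else 0)]
        · rw [sum_const, hfib]
          simp
        · intro d hd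
          simp only [mem_filter, mem_univ, true_and] at hd
          simp [hd]
    _ = ∑ x : T × Fin s, (if .inr x ∈ U then r else 0) := by
        rw [sum_comm, ← univ_product_univ, sum_product]
    _ = _ := sum_ite_mem_eq_mul (fun _ => mem_toRight.symm) r

open Classical in
lemma sum_cutWeight_le {σ : D → D} (hσ : σ.Involutive) {τ : D → T} {k r : ℕ}
    (hkr : k + s = r) (hfib : ∀ t, #{d | τ d = t} = r)
    (hfix : ∀ d e, σ d = d → σ e = e → d = e)
    {S : Finset (Finset (D ⊕ T × Fin s))} {U : Finset (D ⊕ T × Fin s)}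
    (hS : ∀ C ∈ S, ∀ C' ∈ S, C ≠ C' → Disjoint C C')
    (hSU : ∀ C ∈ S, ∀ x ∈ C, ∀ y, (factorGadget σ τ s).Adj x y → y ∈ C ∨ y ∈ U) :
    ∑ C ∈ S, ∑ d, cutWeight σ τ k C d ≤ r * #U + k := by
  calc ∑ C ∈ S, ∑ d, cutWeight σ τ k C d
      ≤ ∑ C ∈ S, ∑ d, _ :=
        sum_le_sum fun C hC => sum_le_sum fun d _ => cutWeight_le hσ k (hSU C hC) d
    _ = ∑ d, ∑ C ∈ S, _ := sum_comm
    _ ≤ ∑ d, (∑ i : Fin s, (if .inr (τ d, i) ∈ U then 1 else 0) +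
        ((if .inl (σ d) ∈ U then k else 0) + (if σ d = d then k else 0)) +
        (if .inl d ∈ U then s else 0)) := by
      refine sum_le_sum fun d _ => ?_
      rw [sum_add_distrib]
      refine add_le_add (sum_ite_mem_le hS _ _) ?_
      split_ifs
      · rw [sum_comm]
        refine (sum_le_sum fun i _ => sum_ite_mem_le hS _ 1).trans ?_
        simp
      · simp
    _ ≤ r * #U + k := by
      simp only [sum_add_distrib]
      have h2 : ∑ d, (if .inl d ∈ U then k else 0) = k * #U.toLeft :=
        sum_ite_mem_eq_mul (fun _ => mem_toLeft.symm) k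
      have h3 : ∑ d, (if .inl (σ d) ∈ U then k else 0) = k * #U.toLeft := by
        rw [← h2]
        exact Equiv.sum_comp (hσ.toPerm) (fun d => if .inl d ∈ U then k else 0)
      have h4 : ∑ d, (if .inl d ∈ U then s else 0) = s * #U.toLeft :=
        sum_ite_mem_eq_mul (fun _ => mem_toLeft.symm) s
      have h5 : ∑ d, (if σ d = d then k else 0) ≤ k := by
        rw [← sum_filter, sum_const, smul_eq_mul]
        have : #{d | σ d = d} ≤ 1 := by
          rw [card_le_one]
          intro a ha b hb
          simp only [mem_filter, mem_univ, true_and] at ha hb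
          exact hfix a b ha hb
        nlinarith
      rw [sum_sum_ite_inr_mem hfib, h3, h4, ← card_toLeft_add_card_toRight (u := U), ← hkr]
      nlinarith

open Classical in
lemma card_le_card_of_odd {σ : D → D} (hσ : σ.Involutive) {τ : D → T} {k r : ℕ}
    (hk : Even k) (hkr : k + s = r) (hrs : r ≤ 3 * s) (hs : 0 < s)
    (hfib : ∀ t, #{d | τ d = t} = r)
    (hfix : ∀ d e, σ d = d → σ e = e → d = e)
    (hcut : ∀ B : Finset T, B.Nonempty → B ≠ univ →
      1 < #{d | τ d ∈ B ∧ (σ d = d ∨ τ (σ d) ∉ B)})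
    {S : Finset (Finset (D ⊕ T × Fin s))} {U : Finset (D ⊕ T × Fin s)}
    (hS : ∀ C ∈ S, ∀ C' ∈ S, C ≠ C' → Disjoint C C')
    (hU : ∀ C ∈ S, Disjoint C U)
    (hSU : ∀ C ∈ S, ∀ x ∈ C, ∀ y, (factorGadget σ τ s).Adj x y → y ∈ C ∨ y ∈ U)
    (hodd : ∀ C ∈ S, Odd #C) : #S ≤ #U := by
  by_cases hsp : ∃ d, σ d = d ∧ univ.erase (.inl d) ∈ S
  · obtain ⟨d, hd, hmem⟩ := hsp
    have hdU : .inl d ∈ U := by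
      have := hSU _ hmem (.inr (τ d, ⟨0, hs⟩)) (by simp) (.inl d)
        (factorGadget_adj_inl_inr (σ := σ).2 rfl).symm
      simpa using this
    have : #S ≤ 1 := by
      rw [card_le_one_iff_subset_singleton]
      refine ⟨univ.erase (.inl d), fun C hC => ?_⟩
      rw [mem_singleton]
      by_contra hne
      obtain ⟨x, hx⟩ := card_pos.1 (hodd C hC).pos
      have h1 := disjoint_left.1 (hS C hC _ hmem hne) hx
      obtain rfl : x = .inl d := by simpa using h1
      exact disjoint_left.1 (hU C hC) hx hdU
    exact this.trans (card_pos.2 ⟨_, hdU⟩)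
  · have h1 : #S * r ≤ ∑ C ∈ S, ∑ d, cutWeight σ τ k C d := by
      rw [← smul_eq_mul]
      refine card_nsmul_le_sum _ _ _ fun C hC => ?_
      refine (le_sum_cutWeight hσ hk hkr hrs hfib hcut C (hodd C hC)).resolve_right ?_
      rintro ⟨d, hd, rfl⟩
      exact hsp ⟨d, hd, hC⟩
    have h2 := sum_cutWeight_le hσ hkr hfib hfix hS hSU
    by_contra! h
    nlinarith

open Classical in
/-- A factor theorem for graphs given by their darts `D`, with endpoint map `τ` and reversal `σ`, in
which at most one dart has no reverse (and is fixed by `σ`). If the graph is `r`-regular and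
bridgeless, it has a `k`-factor for every even `k` with `3 * k ≤ 2 * r` and `k < r`. -/
lemma exists_factor_of_one_lt_cut {σ : D → D} (hσ : σ.Involutive) {τ : D → T} {k r : ℕ}
    (hk : Even k) (hkr : 3 * k ≤ 2 * r) (hkr' : k < r)
    (hfib : ∀ t, #{d | τ d = t} = r)
    (hfix : ∀ d e, σ d = d → σ e = e → d = e)
    (hcut : ∀ B : Finset T, B.Nonempty → B ≠ univ →
      1 < #{d | τ d ∈ B ∧ (σ d = d ∨ τ (σ d) ∉ B)}) :
    ∃ F : Finset D, (∀ d ∈ F, σ d ≠ d ∧ σ d ∈ F) ∧ ∀ t, #{d ∈ F | τ d = t} = k := by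
  obtain ⟨s, rfl⟩ := Nat.exists_eq_add_of_lt hkr'
  set s' := s + 1 with hs'
  have hM : ∃ M : (factorGadget σ τ s').Subgraph, M.IsPerfectMatching := by
    rw [SimpleGraph.tutte]
    intro U hU
    rw [SimpleGraph.IsTutteViolator] at hU
    set G' := ((⊤ : (factorGadget σ τ s').Subgraph).deleteVerts U).coe with hG'
    let f : G'.ConnectedComponent → Finset (D ⊕ T × Fin s') := fun c =>
      (Subtype.val '' c.supp).toFinset
    have hfm : ∀ c x, x ∈ f c ↔ ∃ h, G'.connectedComponentMk ⟨x, h⟩ = c := by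
      intro c x
      simp [f]
    have hfdis : ∀ c c', c ≠ c' → Disjoint (f c) (f c') := by
      intro c c' hne
      rw [disjoint_left]
      intro x hx hx'
      rw [hfm] at hx hx'
      obtain ⟨h, rfl⟩ := hx
      obtain ⟨h', rfl⟩ := hx'
      exact hne rfl
    have hfcard : ∀ c, #(f c) = c.supp.ncard := by
      intro c
      rw [← Set.ncard_eq_toFinset_card', Set.ncard_image_of_injective _ Subtype.val_injective]
    have hfinj : Set.InjOn f (G'.oddComponents.toFinset : Set G'.ConnectedComponent) := by
      intro c hc c' _ hcc'
      by_contra hne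
      have := hfdis c c' hne
      rw [← hcc', disjoint_self_iff_empty] at this
      have h2 := hfcard c
      simp only [Set.coe_toFinset, Set.mem_ofPred_eq] at hc
      rw [this, card_empty] at h2
      rw [← h2] at hc
      simp at hc
    have := card_le_card_of_odd (S := G'.oddComponents.toFinset.image f) (U := U.toFinset)
      hσ hk (s := s') rfl (by omega) (by omega) hfib hfix hcut ?_ ?_ ?_ ?_
    · rw [card_image_of_injOn hfinj, ← Set.ncard_eq_toFinset_card',
        ← Set.ncard_eq_toFinset_card'] at this
      omega
    · simp only [mem_image]
      rintro _ ⟨c, -, rfl⟩ _ ⟨c', -, rfl⟩ hne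
      exact hfdis _ _ fun h => hne (h ▸ rfl)
    · simp only [mem_image]
      rintro _ ⟨c, -, rfl⟩
      rw [disjoint_left]
      intro x hx
      obtain ⟨h, -⟩ := (hfm _ _).1 hx
      simpa using h
    · simp only [mem_image]
      rintro _ ⟨c, -, rfl⟩ x hx y hxy
      obtain ⟨h, rfl⟩ := (hfm _ _).1 hx
      by_cases hy : y ∈ U
      · right
        simpa using hy
      · left
        rw [hfm]
        have hxU : x ∉ U := by simpa using h
        refine ⟨by simpa using hy, ?_⟩
        refine SimpleGraph.ConnectedComponent.connectedComponentMk_eq_of_adj ?_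
        simp [hG', hxU, hy, hxy.symm]
    · simp only [mem_image]
      rintro _ ⟨c, hc, rfl⟩
      rw [hfcard]
      simpa using hc
  obtain ⟨M, hM⟩ := hM
  rw [SimpleGraph.Subgraph.isPerfectMatching_iff] at hM
  refine ⟨({d | M.Adj (.inl d) (.inl (σ d))} : Finset D), ?_, ?_⟩
  · intro d hd
    simp only [mem_filter, mem_univ, true_and] at hd ⊢
    rw [hσ]
    exact ⟨fun h => M.loopless.irrefl _ (by rwa [h] at hd), hd.symm⟩
  · intro t
    have hcompl : #{d ∈ ({d | τ d = t} : Finset D) | ¬ M.Adj (.inl d) (.inl (σ d))} = s' := by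
      have hex : ∀ i : Fin s', ∃ d, τ d = t ∧ M.Adj (.inr (t, i)) (.inl d) := by
        intro i
        obtain ⟨y, hy, -⟩ := hM (.inr (t, i))
        rcases y with d | y
        · exact ⟨d, factorGadget_adj_inl_inr.1 hy.adj_sub.symm, hy⟩
        · exact absurd hy.adj_sub factorGadget_adj_inr_inr
      choose g hg1 hg2 using hex
      have hginj : g.Injective := by
        intro i j hij
        have := (hM (.inl (g i))).unique (hg2 i).symm (by rw [hij]; exact (hg2 j).symm)
        simpa using this
      have : ({d ∈ ({d | τ d = t} : Finset D) | ¬ M.Adj (.inl d) (.inl (σ d))}) =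
          univ.image g := by
        ext d
        simp only [mem_filter, mem_univ, true_and, mem_image]
        constructor
        · rintro ⟨rfl, hd⟩
          obtain ⟨y, hy, -⟩ := hM (.inl d)
          rcases y with e | ⟨t, i⟩
          · obtain ⟨-, rfl⟩ := (factorGadget_adj_inl_inl hσ).1 hy.adj_sub
            exact absurd hy hd
          · obtain rfl : τ d = t := factorGadget_adj_inl_inr.1 hy.adj_sub
            refine ⟨i, ?_⟩
            have := (hM (.inr (τ d, i))).unique (hg2 i) hy.symm
            simpa using this
        · rintro ⟨i, rfl⟩
          refine ⟨hg1 i, fun h => ?_⟩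
          have := (hM (.inl (g i))).unique (hg2 i).symm h
          simp at this
      rw [this, card_image_of_injective _ hginj, card_univ, Fintype.card_fin]
    have h1 := card_filter_add_card_filter_not (s := ({d | τ d = t} : Finset D))
      (fun d => M.Adj (.inl d) (.inl (σ d)))
    rw [hcompl, hfib, filter_comm] at h1
    omega

end Gadget

open Classical in
lemma degenerate_of_forall_finset {V : Type*} [Fintype V] {G : SimpleGraph V} {d : ℕ}
    (h : ∀ S : Finset V, S.Nonempty → ∃ v ∈ S, #{u ∈ S | G.Adj v u} ≤ d) : Degenerate G d := by
  have key : ∀ n, ∀ S : Finset V, #S = n → ∃ o : V → ℕ, Set.InjOn o S ∧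
      ∀ v ∈ S, #{u ∈ S | G.Adj v u ∧ o u < o v} ≤ d := by
    intro n
    induction n with
    | zero =>
      intro S hS
      rw [card_eq_zero] at hS
      subst hS
      exact ⟨fun _ => 0, by simp, by simp⟩
    | succ n ih =>
      intro S hS
      obtain ⟨v, hv, hvd⟩ := h S (card_pos.1 (by omega))
      obtain ⟨o, ho, hod⟩ := ih (S.erase v) (by rw [card_erase_of_mem hv, hS]; rfl)
      have hlt : ∀ u, o u < univ.sup o + 1 := fun u => Nat.lt_succ_of_le (le_sup (mem_univ u))
      refine ⟨Function.update o v (univ.sup o + 1), ?_, ?_⟩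
      · intro a ha b hb hab
        by_cases hav : a = v <;> by_cases hbv : b = v
        · rw [hav, hbv]
        · have := hlt b
          simp_all
        · have := hlt a
          simp_all
        · simp only [ne_eq, hav, not_false_eq_true, Function.update_of_ne, hbv] at hab
          exact ho (by simp [hav, mem_coe.1 ha]) (by simp [hbv, mem_coe.1 hb]) hab
      · intro w hw
        by_cases hwv : w = v
        · subst hwv
          exact (card_le_card (monotone_filter_right _ fun u _ hu => hu.1)).trans hvd
        · refine (card_le_card ?_).trans (hod w (mem_erase.2 ⟨hwv, hw⟩))
          intro u hu
          simp only [mem_filter, mem_erase, Function.update_of_ne hwv] at hu ⊢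
          have huv : u ≠ v := by
            rintro rfl
            have := hlt w
            rw [Function.update_self] at hu
            omega
          rw [Function.update_of_ne huv] at hu
          exact ⟨⟨huv, hu.1⟩, hu.2⟩
  obtain ⟨o, ho, hod⟩ := key _ univ rfl
  refine ⟨o, fun a b hab => ho (by simp) (by simp) hab, fun v => ?_⟩
  rw [Set.ncard_eq_toFinset_card']
  convert hod v (mem_univ v)
  ext u
  simp

open Classical in
/-- A graph with more than `(p - 1) * #S` edges, all inside the vertex set `S`, has a nonempty
`p`-divisible subgraph. -/
lemma exists_prime_divisible_subgraph {V : Type*} [Fintype V] {G : SimpleGraph V} {p : ℕ}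
    [Fact p.Prime] {S : Finset V} (hS : ∀ u v, G.Adj u v → u ∈ S)
    (hcard : #S * (p - 1) < Fintype.card G.edgeSet) :
    ∃ H ≤ G, H ≠ ⊥ ∧ KDivisible p H := by
  have hp : p.Prime := Fact.out
  let f : V → MvPolynomial G.edgeSet (ZMod p) := fun v =>
    ∑ e with v ∈ e.1, MvPolynomial.X e ^ (p - 1)
  have hdeg : ∑ v ∈ S, (f v).totalDegree < Fintype.card G.edgeSet := by
    refine lt_of_le_of_lt ?_ hcard
    rw [← smul_eq_mul]
    refine sum_le_card_nsmul _ _ _ fun v _ => ?_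
    refine MvPolynomial.totalDegree_finsetSum_le fun e _ => ?_
    rw [MvPolynomial.totalDegree_X_pow]
  have hdvd : p ∣ Fintype.card {x : G.edgeSet → ZMod p //
      ∀ v ∈ S, MvPolynomial.eval x (f v) = 0} := by
    convert char_dvd_card_solutions_of_sum_lt p hdeg
  have h0 : ∀ v ∈ S, MvPolynomial.eval (0 : G.edgeSet → ZMod p) (f v) = 0 := by
    intro v _
    simp only [f, map_sum, map_pow, MvPolynomial.eval_X, Pi.zero_apply]
    exact sum_eq_zero fun e _ => zero_pow (by have := hp.two_le; omega)
  have hone : 1 < Fintype.card {x : G.edgeSet → ZMod p //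
      ∀ v ∈ S, MvPolynomial.eval x (f v) = 0} := by
    refine lt_of_lt_of_le hp.one_lt (Nat.le_of_dvd ?_ hdvd)
    exact Fintype.card_pos_iff.2 ⟨⟨0, h0⟩⟩
  obtain ⟨⟨x, hx⟩, hxne⟩ := Fintype.exists_ne_of_one_lt_card hone ⟨0, h0⟩
  have hx0 : x ≠ 0 := fun h => hxne (Subtype.ext h)
  obtain ⟨e, he⟩ := Function.ne_iff.1 hx0
  let H : SimpleGraph V :=
    { Adj := fun u v => ∃ h : s(u, v) ∈ G.edgeSet, x ⟨s(u, v), h⟩ ≠ 0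
      symm := ⟨fun u v ⟨h, h'⟩ => by
        have hs : s(v, u) = s(u, v) := Sym2.eq_swap
        exact ⟨hs ▸ h, by simpa only [hs] using h'⟩⟩
      loopless := ⟨fun u ⟨h, _⟩ => by simp at h⟩ }
  have hHG : H ≤ G := fun u v ⟨h, _⟩ => h
  refine ⟨H, hHG, ?_, ?_⟩
  · intro hbot
    obtain ⟨e, heG⟩ := e
    induction e with
    | h u v =>
      have : H.Adj u v := ⟨heG, he⟩
      simp [hbot] at this
  · intro v
    by_cases hv : v ∈ S
    · rw [← ZMod.natCast_eq_zero_iff, ← hx v hv]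
      simp only [f, map_sum, map_pow, MvPolynomial.eval_X]
      have h1 : ∀ e : G.edgeSet, x e ^ (p - 1) = if x e ≠ 0 then 1 else 0 := by
        intro e
        split_ifs with h
        · exact ZMod.pow_card_sub_one_eq_one h
        · rw [not_not] at h
          rw [h, zero_pow (by have := hp.two_le; omega)]
      simp only [h1, sum_boole, filter_filter]
      congr 1
      rw [Set.ncard_eq_toFinset_card']
      refine card_bij (fun u hu => ⟨s(v, u), hHG (by simpa using hu)⟩) ?_ ?_ ?_
      · intro u hu
        have : H.Adj v u := by simpa using hu
        obtain ⟨h, h'⟩ := this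
        simpa using h'
      · intro a _ b _ hab
        exact Sym2.congr_right.1 (congrArg Subtype.val hab)
      · rintro ⟨e, heG⟩ hb
        simp only [mem_filter, mem_univ, true_and] at hb
        obtain ⟨u, rfl⟩ := Sym2.mem_iff_exists.1 hb.1
        exact ⟨u, by simpa using (show H.Adj v u from ⟨heG, hb.2⟩), rfl⟩
    · have : {u | H.Adj v u} = ∅ := by
        ext u
        simpa using fun h => hv (hS v u (hHG h))
      simp [this]

open Classical in
/-- If the fibres of `f` have cardinality divisible by `r`, they can be split into parts of
size `r`. -/
lemma exists_refinement_of_dvd_card_fiber {D V : Type} [Fintype D] [Fintype V] {f : D → V} {r : ℕ}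
    (hf : ∀ v, r ∣ #{d | f d = v}) :
    ∃ (T : Type) (_ : Fintype T) (τ : D → T) (g : T → V), g ∘ τ = f ∧ ∀ t, #{d | τ d = t} = r := by
  choose m hm using hf
  have he : ∀ v, Nonempty ({d // f d = v} ≃ Fin (m v) × Fin r) := by
    intro v
    rw [← Fintype.card_eq]
    simp [Fintype.card_subtype, hm, mul_comm]
  let e := fun v => (he v).some
  refine ⟨Σ v, Fin (m v), inferInstance, fun d => ⟨f d, (e (f d) ⟨d, rfl⟩).1⟩, Sigma.fst, rfl, ?_⟩
  rintro ⟨v, i⟩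
  refine Eq.trans (Eq.symm ?_) (card_fin r)
  have hτ : ∀ v (d : {d // f d = v}),
      (⟨f d, (e (f d) ⟨d, rfl⟩).1⟩ : Σ v, Fin (m v)) = ⟨v, (e v d).1⟩ := by
    rintro v ⟨d, rfl⟩
    rfl
  refine card_bij (fun j _ => ((e v).symm (i, j)).1) ?_ ?_ ?_
  · intro j _
    simp only [mem_filter, mem_univ, true_and]
    exact (hτ v _).trans (by simp)
  · intro a _ b _ hab
    simpa using Subtype.ext hab
  · intro d hd
    simp only [mem_filter, mem_univ, true_and] at hd
    obtain rfl : f d = v := congrArg Sigma.fst hd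
    simp only [Sigma.mk.injEq, heq_eq_eq, true_and] at hd
    refine ⟨(e (f d) ⟨d, rfl⟩).2, mem_univ _, ?_⟩
    rw [← hd]
    simp

open Classical in
/-- Every `r`-regular multigraph (with darts `D`, endpoint map `τ` and reversal `σ`) has a nonempty
`k`-regular subgraph for every positive even `k < r` with `3 * k ≤ 2 * r`. -/
lemma exists_regular_subgraph {D T : Type*} [Fintype D] [Fintype T] [Nonempty T] {σ : D → D}
    (hσ : σ.Involutive) (hσ' : ∀ d, σ d ≠ d) {τ : D → T} {k r : ℕ}
    (hk : Even k) (hk0 : 0 < k) (hkr : 3 * k ≤ 2 * r) (hkr' : k < r)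
    (hfib : ∀ t, #{d | τ d = t} = r) :
    ∃ F : Finset D, F.Nonempty ∧ (∀ d ∈ F, σ d ∈ F) ∧ ∀ t, k ∣ #{d ∈ F | τ d = t} := by
  let δ : Finset T → Finset D := fun B => {d | τ d ∈ B ∧ τ (σ d) ∉ B}
  obtain ⟨W, hW, hmin⟩ := exists_min_image ({W | W.Nonempty ∧ #(δ W) ≤ 1} : Finset (Finset T)) card
    ⟨univ, by simp [δ, univ_nonempty]⟩
  simp only [mem_filter, mem_univ, true_and] at hW hmin
  obtain ⟨⟨t₀, ht₀⟩, hW1⟩ := hW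
  let σ' : {d // τ d ∈ W} → {d // τ d ∈ W} := fun d =>
    if h : τ (σ d) ∈ W then ⟨σ d, h⟩ else d
  let τ' : {d // τ d ∈ W} → {t // t ∈ W} := fun d => ⟨τ d, d.2⟩
  have hσ'v : ∀ d, τ (σ d.1) ∈ W → (σ' d).1 = σ d := fun d h => by simp [σ', h]
  have hσ'f : ∀ d, σ' d = d ↔ τ (σ d.1) ∉ W := by
    intro d
    by_cases h : τ (σ d.1) ∈ W
    · simp only [h, not_true, iff_false]
      intro h'
      exact hσ' d (by rw [← hσ'v d h, h'])
    · simp [σ', h]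
  have hcard : ∀ (F : Finset {d // τ d ∈ W}) (t : {t // t ∈ W}),
      #{d ∈ F | τ' d = t} = #{d ∈ F.map (Function.Embedding.subtype _) | τ d = t.1} := by
    intro F t
    rw [filter_map, card_map]
    exact congrArg card (filter_congr fun d _ => by simp [τ', Subtype.ext_iff])
  have hinv : σ'.Involutive := by
    intro d
    by_cases h : τ (σ d.1) ∈ W
    · have h1 := hσ'v d h
      apply Subtype.ext
      rw [hσ'v, h1, hσ]
      rw [h1, hσ]
      exact d.2
    · rw [(hσ'f d).2 h, (hσ'f d).2 h]
  have hfib' : ∀ t, #{d | τ' d = t} = r := by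
    intro t
    rw [← hfib t.1]
    refine Eq.trans (by convert hcard univ t) (congrArg card ?_)
    ext d
    simp only [mem_filter, mem_map, mem_univ, true_and, Function.Embedding.subtype_apply,
      Subtype.exists, exists_prop, exists_eq_right, and_iff_right_iff_imp]
    rintro h
    exact h ▸ t.2
  have hfix : ∀ d e, σ' d = d → σ' e = e → d = e := by
    intro d e hd he
    rw [hσ'f] at hd he
    exact Subtype.ext (card_le_one.1 hW1 d.1 (by simp [δ, d.2, hd]) e.1 (by simp [δ, e.2, he]))
  have hcut : ∀ B : Finset {t // t ∈ W}, B.Nonempty → B ≠ univ →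
      1 < #{d | τ' d ∈ B ∧ (σ' d = d ∨ τ' (σ' d) ∉ B)} := by
    intro B hB hBu
    by_contra! hle
    let B' : Finset T := B.map (Function.Embedding.subtype _)
    have hB'W : ∀ t, t ∈ B' ↔ ∃ h : t ∈ W, ⟨t, h⟩ ∈ B := by
      intro t
      simp [B']
    have hlt : #B' < #W := by
      rw [card_map, ← Fintype.card_coe W]
      exact card_lt_univ_of_notMem (not_forall.1 fun h => hBu (eq_univ_iff_forall.2 h)).choose_spec
    refine absurd (hmin B' ⟨by simpa [B'] using hB, ?_⟩) (not_le.2 hlt)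
    refine le_trans ?_ hle
    rw [← card_map (Function.Embedding.subtype _)]
    refine card_le_card fun d hd => ?_
    simp only [δ, mem_filter, mem_univ, true_and, hB'W] at hd
    obtain ⟨⟨hdW, hdB⟩, hd2⟩ := hd
    refine mem_map.2 ⟨⟨d, hdW⟩, ?_, rfl⟩
    simp only [mem_filter, mem_univ, true_and]
    refine ⟨hdB, ?_⟩
    by_cases h : τ (σ d) ∈ W
    · right
      intro h'
      refine hd2 ⟨h, ?_⟩
      convert h' using 2
      rw [hσ'v _ h]
    · left
      exact (hσ'f _).2 h
  obtain ⟨F, hF, hFk⟩ := exists_factor_of_one_lt_cut hinv hk hkr hkr'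
    (by convert hfib') hfix (by convert hcut)
  refine ⟨F.map (Function.Embedding.subtype _), ?_, ?_, ?_⟩
  · rw [map_nonempty]
    have := hFk ⟨t₀, ht₀⟩
    by_contra h
    rw [not_nonempty_iff_eq_empty] at h
    simp [h] at this
    omega
  · intro d hd
    obtain ⟨d, hdF, rfl⟩ := mem_map.1 hd
    obtain ⟨h1, h2⟩ := hF d hdF
    rw [Ne, hσ'f, not_not] at h1
    exact mem_map.2 ⟨σ' d, h2, hσ'v d h1⟩
  · intro t
    by_cases ht : t ∈ W
    · exact dvd_of_eq ((hFk ⟨t, ht⟩).symm.trans (by convert hcard F ⟨t, ht⟩))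
    · rw [filter_eq_empty_iff.2, card_empty]
      · exact dvd_zero k
      · intro d hd h
        obtain ⟨d, -, rfl⟩ := mem_map.1 hd
        exact ht (h ▸ d.2)

open Classical in
lemma exists_divisible_subgraph_of_prime_divisible {V : Type} [Fintype V] {H : SimpleGraph V}
    {k r : ℕ} (hk : Even k) (hk0 : 0 < k) (hkr : 3 * k ≤ 2 * r) (hkr' : k < r)
    (hH : KDivisible r H) (hne : H ≠ ⊥) :
    ∃ H' ≤ H, H' ≠ ⊥ ∧ KDivisible k H' := by
  have hfst : ∀ v, r ∣ #{d : H.Dart | d.fst = v} := by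
    intro v
    rw [H.dart_fst_fiber_card_eq_degree]
    rw [← SimpleGraph.card_neighborFinset_eq_degree, SimpleGraph.neighborFinset_def,
      ← Set.ncard_eq_toFinset_card']
    exact hH v
  obtain ⟨T, _, τ, g, hg, hτ⟩ := exists_refinement_of_dvd_card_fiber hfst
  obtain ⟨a, b, hab⟩ := SimpleGraph.ne_bot_iff_exists_adj.1 hne
  have : Nonempty T := ⟨τ ⟨(a, b), hab⟩⟩
  obtain ⟨F, ⟨d₀, hd₀⟩, hFσ, hFk⟩ := exists_regular_subgraph
    SimpleGraph.Dart.symm_involutive SimpleGraph.Dart.symm_ne hk hk0 hkr hkr' hτ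
  let H' : SimpleGraph V :=
    { Adj := fun u v => ∃ h : H.Adj u v, ⟨(u, v), h⟩ ∈ F
      symm := ⟨fun u v ⟨h, h'⟩ => ⟨h.symm, hFσ _ h'⟩⟩
      loopless := ⟨fun u ⟨h, _⟩ => H.irrefl h⟩ }
  refine ⟨H', fun u v ⟨h, _⟩ => h, ?_, ?_⟩
  · exact SimpleGraph.ne_bot_iff_exists_adj.2 ⟨d₀.fst, d₀.snd, d₀.adj, hd₀⟩
  · intro v
    have h1 : {u | H'.Adj v u}.ncard = #{d ∈ F | d.fst = v} := by
      rw [Set.ncard_eq_toFinset_card']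
      refine card_bij (fun u hu => ⟨(v, u), (show H'.Adj v u by simpa using hu).1⟩) ?_ ?_ ?_
      · intro u hu
        have : H'.Adj v u := by simpa using hu
        simpa using this.2
      · intro u _ w _ h
        simpa using h
      · rintro ⟨⟨a, u⟩, h⟩ hd
        obtain ⟨hdF, rfl⟩ := mem_filter.1 hd
        exact ⟨u, by simpa using (show H'.Adj a u from ⟨h, hdF⟩), rfl⟩
    rw [h1, card_eq_sum_card_fiberwise (f := τ) (t := univ) (by intro d; simp)]
    refine dvd_sum fun t _ => ?_
    by_cases ht : g t = v
    · refine (hFk t).trans (dvd_of_eq (congrArg card ?_))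
      rw [filter_filter]
      refine filter_congr fun d _ => Iff.symm ?_
      refine and_iff_right_of_imp fun h => ?_
      rw [← ht, ← h]
      exact (congrFun hg d).symm
    · rw [filter_eq_empty_iff.2, card_empty]
      · exact dvd_zero k
      · intro d hd h
        apply ht
        rw [← (mem_filter.1 hd).2, ← h]
        exact congrFun hg d

open Classical in
lemma exists_prime_divisible_subgraph_of_le_degree {V : Type*} [Fintype V] {G : SimpleGraph V}
    {p : ℕ} [Fact p.Prime] {S : Finset V} (hS : S.Nonempty)
    (hdeg : ∀ v ∈ S, 2 * p - 2 < #{u ∈ S | G.Adj v u}) :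
    ∃ H ≤ G, H ≠ ⊥ ∧ KDivisible p H := by
  obtain ⟨G', hG'⟩ : ∃ G' : SimpleGraph V, ∀ u v, G'.Adj u v ↔ G.Adj u v ∧ u ∈ S ∧ v ∈ S :=
    ⟨{ Adj := fun u v => G.Adj u v ∧ u ∈ S ∧ v ∈ S
       symm := ⟨fun u v h => ⟨h.1.symm, h.2.2, h.2.1⟩⟩
       loopless := ⟨fun u h => G.irrefl h.1⟩ }, fun _ _ => Iff.rfl⟩
  have hedges : #S * (p - 1) < Fintype.card G'.edgeSet := by
    have h1 := G'.sum_degrees_eq_twice_card_edges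
    have h2 : #S * (2 * p - 2 + 1) ≤ ∑ v ∈ S, G'.degree v := by
      rw [← smul_eq_mul]
      refine card_nsmul_le_sum _ _ _ fun v hv => ?_
      rw [← SimpleGraph.card_neighborFinset_eq_degree]
      refine (Nat.succ_le_of_lt (hdeg v hv)).trans (card_le_card fun u hu => ?_)
      obtain ⟨hu, huv⟩ := mem_filter.1 hu
      rw [SimpleGraph.mem_neighborFinset, hG']
      exact ⟨huv, hv, hu⟩
    have h3 : ∑ v ∈ S, G'.degree v ≤ ∑ v, G'.degree v :=
      sum_le_univ_sum_of_nonneg fun _ => Nat.zero_le _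
    have h4 := card_pos.2 hS
    rw [SimpleGraph.edgeFinset_card] at h1
    have h5 : 2 * p - 2 + 1 = 2 * (p - 1) + 1 := by omega
    rw [h5, mul_add, mul_one, mul_left_comm] at h2
    omega
  obtain ⟨H, hH, h⟩ := exists_prime_divisible_subgraph (S := S) (fun u v h => ((hG' u v).1 h).2.1) hedges
  exact ⟨H, hH.trans fun u v h => ((hG' u v).1 h).1, h⟩

lemma prime_q_and_le (m : ℕ) : (q m).Prime ∧ m ≤ q m := by
  obtain ⟨p, hp, hp'⟩ := Nat.exists_infinite_primes m
  exact Nat.sInf_mem (s := {p : ℕ | p.Prime ∧ m ≤ p}) ⟨p, hp', hp⟩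

theorem statement14 (k : ℕ) (hk : 2 ≤ k) (hkeven : Even k)
    (V : Type) [Fintype V] (G : SimpleGraph V) (hG : NoKDivisibleSubgraph k G) :
    Degenerate G (2 * q (3 * k / 2) - 2) := by
  classical
  obtain ⟨hp, hle⟩ := prime_q_and_le (3 * k / 2)
  have : Fact (q (3 * k / 2)).Prime := ⟨hp⟩
  refine degenerate_of_forall_finset fun S hS => ?_
  by_contra! hdeg
  obtain ⟨H, hHG, hne, hH⟩ := exists_prime_divisible_subgraph_of_le_degree hS
    (by convert hdeg)
  obtain ⟨j, rfl⟩ := hkeven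
  obtain ⟨H', hH', hne', hdiv⟩ := exists_divisible_subgraph_of_prime_divisible ⟨j, rfl⟩
    (by omega) (by omega) (by omega) hH hne
  exact hne' (hG H' (hH'.trans hHG) hdiv)
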